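/- Let L ∈ ℝ^{n×n} be the Laplacian of a weighted directed graph and fix a Jordan decomposition P^{−1} L P = J = diag(J_0, …, J_s) with P^{−1} = (η¹, …, ηⁿ). Let λ_0, …, λ_t (t ≤ s) be the distinct eigenvalues of L, let k_i be the geometric multiplicity of λ_i (the number of Jordan blocks with eigenvalue λ_i), and let m_{i_1}, …, m_{i_{k_i}} be the last-row indices of the Jordan blocks with eigenvalue λ_i. For column indices c_1, …, c_r, define Ω_{λ_i} ∈ ℂ^{k_i × r} by (Ω_{λ_i})_{pq} = η^{c_q}_{m_{i_p}}. Then the pair (L, B) with B = (e_{c_1}, …, e_{c_r}) is controllable if and only if rank(Ω_{λ_i}) = k_i for every i = 0, 1, …, t. Consequently, the system is r-leaders controllable (r is the minimum number of standard-basis input columns achieving controllability) with leaders c_1, …, c_r if and only if the columns η^{c_1}, …, η^{c_r} satisfy this rank condition and no combination of fewer than r columns of P^{−1} satisfies it. -/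

import Mathlib

open Matrix
open scoped Classical

/-- The controllability matrix of the pair `(L, B)` where the columns of `B` are the
standard basis vectors `e_{c q}`, `q : ι`. -/
noncomputable def ctrbMatMulti {n : ℕ} {ι : Type*} [Fintype ι]
    (L : Matrix (Fin n) (Fin n) ℝ) (c : ι → Fin n) :
    Matrix (Fin n) (Fin n × ι) ℝ :=
  Matrix.of fun i p => ((L ^ (p.1 : ℕ)).mulVec (Pi.single (c p.2) 1)) i

/-- The matrix `Ω_μ`: the submatrix of `P⁻¹` with rows the last rows of the Jordan blocks
with eigenvalue `μ` and columns indexed by the leaders `c`. -/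
noncomputable def omegaMat {n : ℕ} {ι : Type*} [Fintype ι]
    (Pinv : Matrix (Fin n) (Fin n) ℂ) (d t : Fin n → ℂ) (μ : ℂ) (c : ι → Fin n) :
    Matrix {m : Fin n // ((m : ℕ) = n - 1 ∨ t m = 0) ∧ d m = μ} ι ℂ :=
  Matrix.of fun m q => Pinv (m : Fin n) (c q)

open Polynomial in
theorem vecMul_pow_apply_eq_zero {n : ℕ} (A : Matrix (Fin n) (Fin n) ℂ) (y : Fin n → ℂ)
    (j : Fin n) (h : ∀ k < n, (y ᵥ* A ^ k) j = 0) (k : ℕ) : (y ᵥ* A ^ k) j = 0 := by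
  rcases Nat.eq_zero_or_pos n with hn | hn
  · subst hn; exact j.elim0
  have : Nonempty (Fin n) := ⟨j⟩
  have hdeg : ((X ^ k : ℂ[X]) %ₘ A.charpoly).natDegree < n := by
    have h1 := natDegree_modByMonic_lt (X ^ k : ℂ[X]) A.charpoly_monic (by
      intro h1
      have h2 := A.charpoly_natDegree_eq_dim
      simp [h1] at h2
      omega)
    simpa [A.charpoly_natDegree_eq_dim] using h1
  rw [Matrix.pow_eq_aeval_mod_charpoly, aeval_eq_sum_range' hdeg, Matrix.vecMul_sum,
    Finset.sum_apply]
  refine Finset.sum_eq_zero fun i hi => ?_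
  rw [Matrix.vecMul_smul, Pi.smul_apply, h i (Finset.mem_range.1 hi), smul_zero]

/-- The Popov–Belevitch–Hautus criterion for inputs at coordinates, in terms of left
eigenvectors. -/
theorem left_eigenvector_criterion {n : ℕ} {ι : Type*} (A : Matrix (Fin n) (Fin n) ℂ)
    (c : ι → Fin n) :
    (∀ y : Fin n → ℂ, (∀ k < n, ∀ q, (y ᵥ* A ^ k) (c q) = 0) → y = 0) ↔
      ∀ (μ : ℂ) (y : Fin n → ℂ), y ᵥ* A = μ • y → (∀ q, y (c q) = 0) → y = 0 := by
  constructor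
  · intro h μ y hy hc
    refine h y fun k _ q => ?_
    have hk : y ᵥ* A ^ k = μ ^ k • y := by
      induction k with
      | zero => simp
      | succ k ih =>
        rw [pow_succ, ← Matrix.vecMul_vecMul, ih (by omega), Matrix.smul_vecMul, hy, smul_smul,
          pow_succ]
    simp [hk, hc]
  · intro h y hy
    by_contra hy0
    let W : Submodule ℂ (Fin n → ℂ) :=
      ⨅ (k : ℕ) (q : ι), LinearMap.ker (LinearMap.proj (c q) ∘ₗ (A ^ k).vecMulLinear)
    have mem_W (z : Fin n → ℂ) : z ∈ W ↔ ∀ k q, (z ᵥ* A ^ k) (c q) = 0 := by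
      simp [W, Submodule.mem_iInf]
    have hyW : y ∈ W := (mem_W y).2 fun k q =>
      vecMul_pow_apply_eq_zero A y (c q) (fun k hk => hy k hk q) k
    have hW : ∀ z ∈ W, A.vecMulLinear z ∈ W := fun z hz => by
      rw [mem_W] at hz ⊢
      intro k q
      rw [Matrix.vecMulLinear_apply, Matrix.vecMul_vecMul, ← pow_succ']
      exact hz (k + 1) q
    have : Nontrivial W := ⟨⟨y, hyW⟩, 0, fun h0 => hy0 (congrArg Subtype.val h0)⟩
    obtain ⟨μ, hμ⟩ := Module.End.exists_eigenvalue (A.vecMulLinear.restrict hW)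
    obtain ⟨v, hv⟩ := hμ.exists_hasEigenvector
    refine hv.2 (Subtype.ext (h μ v ?_ fun q => ?_))
    · simpa using congrArg Subtype.val hv.apply_eq_smul
    · simpa using (mem_W v).1 v.2 0 q

theorem rank_eq_card_iff_left_kernel {K m n : Type*} [Field K] [Fintype m] [Fintype n]
    (M : Matrix m n K) :
    M.rank = Fintype.card m ↔ ∀ y : m → K, y ᵥ* M = 0 → y = 0 := by
  rw [Matrix.rank_eq_finrank_span_row, eq_comm, ← Set.finrank,
    ← linearIndependent_iff_card_eq_finrank_span, ← Matrix.vecMul_injective_iff]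
  exact injective_iff_map_eq_zero M.vecMulLinear

theorem left_kernel_map_ofReal_iff {m n : Type*} [Fintype m] (M : Matrix m n ℝ) :
    (∀ y : m → ℝ, y ᵥ* M = 0 → y = 0) ↔
      ∀ y : m → ℂ, y ᵥ* M.map (fun x : ℝ => (x : ℂ)) = 0 → y = 0 := by
  constructor
  · intro h y hy
    have hre := h (fun i => (y i).re) (by
      ext j
      simpa [Matrix.vecMul, dotProduct] using congrArg Complex.re (congrFun hy j))
    have him := h (fun i => (y i).im) (by
      ext j
      simpa [Matrix.vecMul, dotProduct] using congrArg Complex.im (congrFun hy j))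
    ext i
    exact Complex.ext (congrFun hre i) (congrFun him i)
  · intro h y hy
    have := h (fun i => (y i : ℂ)) (by
      ext j
      have hj := congrArg (fun x : ℝ => (x : ℂ)) (congrFun hy j)
      simpa [Matrix.vecMul, dotProduct] using hj)
    ext i
    simpa using congrFun this i

theorem rank_ctrbMatMulti_eq_iff {n : ℕ} {ι : Type*} [Fintype ι]
    (L : Matrix (Fin n) (Fin n) ℝ) (c : ι → Fin n) :
    (ctrbMatMulti L c).rank = n ↔
      ∀ (μ : ℂ) (y : Fin n → ℂ), y ᵥ* L.map (fun x : ℝ => (x : ℂ)) = μ • y →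
        (∀ q, y (c q) = 0) → y = 0 := by
  rw [← left_eigenvector_criterion]
  have h1 := (rank_eq_card_iff_left_kernel (ctrbMatMulti L c)).trans
    (left_kernel_map_ofReal_iff _)
  rw [Fintype.card_fin] at h1
  rw [h1]
  refine forall_congr' fun y => imp_congr_left ?_
  have key (k : Fin n) (q : ι) :
      (y ᵥ* (ctrbMatMulti L c).map (fun x : ℝ => (x : ℂ))) (k, q) =
        (y ᵥ* (L.map (fun x : ℝ => (x : ℂ))) ^ (k : ℕ)) (c q) := by
    have hmap : (L.map (fun x : ℝ => (x : ℂ))) ^ (k : ℕ) =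
        (L ^ (k : ℕ)).map (fun x : ℝ => (x : ℂ)) :=
      (Matrix.map_pow L Complex.ofRealHom (k : ℕ)).symm
    rw [hmap]
    simp [ctrbMatMulti, Matrix.vecMul, dotProduct]
  constructor
  · intro h k hk q
    rw [← key ⟨k, hk⟩ q, h, Pi.zero_apply]
  · intro h
    ext ⟨k, q⟩
    rw [key, h k k.2 q, Pi.zero_apply]

section Jordan

variable {n : ℕ} {J : Matrix (Fin n) (Fin n) ℂ} {d t : Fin n → ℂ}

theorem vecMul_jordan_first
    (hJ : ∀ i j, J i j = if j = i then d i else if (j : ℕ) = (i : ℕ) + 1 then t i else 0)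
    (x : Fin n → ℂ) (j : Fin n) (hj : (j : ℕ) = 0) : (x ᵥ* J) j = x j * d j := by
  rw [Matrix.vecMul, dotProduct, Finset.sum_eq_single j]
  · simp [hJ]
  · intro i _ hij
    rw [hJ, if_neg (Ne.symm hij), if_neg (by omega), mul_zero]
  · simp

theorem vecMul_jordan_succ
    (hJ : ∀ i j, J i j = if j = i then d i else if (j : ℕ) = (i : ℕ) + 1 then t i else 0)
    (x : Fin n → ℂ) (i j : Fin n) (hij : (j : ℕ) = (i : ℕ) + 1) :
    (x ᵥ* J) j = x j * d j + x i * t i := by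
  have hne : j ≠ i := fun h => by simp [h] at hij
  rw [Matrix.vecMul, dotProduct, Fintype.sum_eq_add j i hne]
  · simp [hJ, hij, hne]
  · intro k hk
    rw [hJ, if_neg (Ne.symm hk.1), if_neg, mul_zero]
    intro h
    exact hk.2 (Fin.ext (by omega))

/-- Left eigenvectors of a Jordan matrix are the vectors supported on the last rows of the
blocks with that eigenvalue. -/
theorem vecMul_jordan_eq_smul_iff
    (hJ : ∀ i j, J i j = if j = i then d i else if (j : ℕ) = (i : ℕ) + 1 then t i else 0)
    (ht01 : ∀ i, t i = 0 ∨ t i = 1)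
    (hblk : ∀ i j : Fin n, (j : ℕ) = (i : ℕ) + 1 → t i = 1 → d j = d i)
    (μ : ℂ) (x : Fin n → ℂ) :
    x ᵥ* J = μ • x ↔
      ∀ i : Fin n, ¬ (((i : ℕ) = n - 1 ∨ t i = 0) ∧ d i = μ) → x i = 0 := by
  constructor
  · intro h
    have hd : ∀ (k : ℕ) (i : Fin n), (i : ℕ) = k → d i ≠ μ → x i = 0 := by
      intro k
      induction k with
      | zero =>
        intro i hi hdi
        have h1 := congrFun h i
        rw [vecMul_jordan_first hJ x i hi, Pi.smul_apply, smul_eq_mul] at h1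
        have h2 : x i * (d i - μ) = 0 := by linear_combination h1
        exact (mul_eq_zero.1 h2).resolve_right (sub_ne_zero.2 hdi)
      | succ k ih =>
        intro j hj hdj
        let i : Fin n := ⟨k, by omega⟩
        have hji : (j : ℕ) = (i : ℕ) + 1 := hj
        have h1 := congrFun h j
        rw [vecMul_jordan_succ hJ x i j hji, Pi.smul_apply, smul_eq_mul] at h1
        have h3 : x i * t i = 0 := by
          rcases ht01 i with h0 | h0
          · simp [h0]
          · rw [ih i rfl (by rwa [← hblk i j hji h0]), zero_mul]
        have h2 : x j * (d j - μ) = 0 := by linear_combination h1 - h3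
        exact (mul_eq_zero.1 h2).resolve_right (sub_ne_zero.2 hdj)
    intro i hi
    by_cases hdi : d i = μ
    · have hi' : (i : ℕ) ≠ n - 1 ∧ t i ≠ 0 := by tauto
      have hti := (ht01 i).resolve_left hi'.2
      let j : Fin n := ⟨i + 1, by omega⟩
      have h1 := congrFun h j
      rw [vecMul_jordan_succ hJ x i j rfl, hblk i j rfl hti, hdi, hti, Pi.smul_apply,
        smul_eq_mul] at h1
      linear_combination h1
    · exact hd i i rfl hdi
  · intro h
    have hxd (j : Fin n) : x j * d j = μ * x j := by
      by_cases hj : d j = μ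
      · rw [hj, mul_comm]
      · rw [h j (fun h' => hj h'.2), zero_mul, mul_zero]
    ext j
    rw [Pi.smul_apply, smul_eq_mul]
    rcases Nat.eq_zero_or_pos (j : ℕ) with hj | hj
    · rw [vecMul_jordan_first hJ x j hj, hxd]
    · let i : Fin n := ⟨j - 1, by omega⟩
      have hji : (j : ℕ) = (i : ℕ) + 1 := by simp only [i]; omega
      have h0 : x i * t i = 0 := by
        by_cases hti : t i = 0
        · rw [hti, mul_zero]
        · rw [h i (fun h' => h'.1.elim (by omega) hti), zero_mul]
      rw [vecMul_jordan_succ hJ x i j hji, hxd, h0, add_zero]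

theorem rank_omegaMat_eq_card_iff {ι : Type*} [Fintype ι]
    (hJ : ∀ i j, J i j = if j = i then d i else if (j : ℕ) = (i : ℕ) + 1 then t i else 0)
    (ht01 : ∀ i, t i = 0 ∨ t i = 1)
    (hblk : ∀ i j : Fin n, (j : ℕ) = (i : ℕ) + 1 → t i = 1 → d j = d i)
    (Q : Matrix (Fin n) (Fin n) ℂ) (c : ι → Fin n) (μ : ℂ) :
    (omegaMat Q d t μ c).rank =
        Fintype.card {m : Fin n // ((m : ℕ) = n - 1 ∨ t m = 0) ∧ d m = μ} ↔
      ∀ x : Fin n → ℂ, x ᵥ* J = μ • x → (∀ q, (x ᵥ* Q) (c q) = 0) → x = 0 := by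
  rw [rank_eq_card_iff_left_kernel]
  have key (x : Fin n → ℂ)
      (hx : ∀ i : Fin n, ¬ (((i : ℕ) = n - 1 ∨ t i = 0) ∧ d i = μ) → x i = 0) (q : ι) :
      ((fun m : {m : Fin n // ((m : ℕ) = n - 1 ∨ t m = 0) ∧ d m = μ} => x m) ᵥ*
        omegaMat Q d t μ c) q = (x ᵥ* Q) (c q) := by
    simp only [omegaMat, Matrix.vecMul, dotProduct, Matrix.of_apply]
    refine Fintype.sum_of_injective Subtype.val Subtype.val_injective _ _ (fun i hi => ?_)
      fun _ => rfl
    rw [hx i fun h => hi ⟨⟨i, h⟩, rfl⟩, zero_mul]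
  simp only [vecMul_jordan_eq_smul_iff hJ ht01 hblk]
  constructor
  · intro h x hx hq
    have h0 := h (fun m => x m) (by ext q; rw [key x hx, hq, Pi.zero_apply])
    ext i
    by_cases hi : ((i : ℕ) = n - 1 ∨ t i = 0) ∧ d i = μ
    · exact congrFun h0 ⟨i, hi⟩
    · exact hx i hi
  · intro h y hy
    let x : Fin n → ℂ := fun i =>
      if hi : ((i : ℕ) = n - 1 ∨ t i = 0) ∧ d i = μ then y ⟨i, hi⟩ else 0
    have hx : ∀ i : Fin n, ¬ (((i : ℕ) = n - 1 ∨ t i = 0) ∧ d i = μ) → x i = 0 :=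
      fun i hi => dif_neg hi
    have hxy : (fun m : {m : Fin n // ((m : ℕ) = n - 1 ∨ t m = 0) ∧ d m = μ} => x m) = y := by
      ext m
      exact dif_pos m.2
    have h0 := h x hx fun q => by rw [← key x hx, hxy, hy, Pi.zero_apply]
    rw [← hxy, h0]
    rfl

end Jordan

theorem rank_ctrbMatMulti_eq_iff_omegaMat {n : ℕ} {ι : Type*} [Fintype ι]
    (L : Matrix (Fin n) (Fin n) ℝ) (P J : Matrix (Fin n) (Fin n) ℂ) (d t : Fin n → ℂ)
    (hP : IsUnit P.det)
    (hJ : ∀ i j, J i j = if j = i then d i else if (j : ℕ) = (i : ℕ) + 1 then t i else 0)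
    (ht01 : ∀ i, t i = 0 ∨ t i = 1)
    (hblk : ∀ i j : Fin n, (j : ℕ) = (i : ℕ) + 1 → t i = 1 → d j = d i)
    (hdecomp : P⁻¹ * (L.map (fun x : ℝ => (x : ℂ))) * P = J) (c : ι → Fin n) :
    (ctrbMatMulti L c).rank = n ↔
      ∀ μ : ℂ, (omegaMat P⁻¹ d t μ c).rank =
        Fintype.card {m : Fin n // ((m : ℕ) = n - 1 ∨ t m = 0) ∧ d m = μ} := by
  rw [rank_ctrbMatMulti_eq_iff]
  refine forall_congr' fun μ => ?_
  rw [rank_omegaMat_eq_card_iff hJ ht01 hblk]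
  have hPP := Matrix.mul_nonsing_inv P hP
  have hPP' := Matrix.nonsing_inv_mul P hP
  constructor
  · intro h x hx hq
    have h0 := h (x ᵥ* P⁻¹) (by
      have hLJ : P⁻¹ * L.map (fun x : ℝ => (x : ℂ)) = J * P⁻¹ := by
        rw [← hdecomp, Matrix.mul_assoc, hPP, Matrix.mul_one]
      rw [Matrix.vecMul_vecMul, hLJ, ← Matrix.vecMul_vecMul, hx, Matrix.smul_vecMul]) hq
    rw [← Matrix.vecMul_one x, ← hPP', ← Matrix.vecMul_vecMul, h0, Matrix.zero_vecMul]
  · intro h y hy hq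
    have hyP : (y ᵥ* P) ᵥ* P⁻¹ = y := by
      rw [Matrix.vecMul_vecMul, hPP, Matrix.vecMul_one]
    have h0 := h (y ᵥ* P) (by
      rw [← hdecomp, ← Matrix.vecMul_vecMul, ← Matrix.vecMul_vecMul, hyP, hy,
        Matrix.smul_vecMul]) (by rwa [hyP])
    rw [← hyP, h0, Matrix.zero_vecMul]

/-- **`r` leaders controllability via the Jordan form of the Laplacian.**
Let `L` be the Laplacian of a weighted directed graph on `n` vertices and fix a Jordan
decomposition `P⁻¹ L P = J`, where `J` is encoded by its diagonal `d` and superdiagonal `t`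
(`t i ∈ {0,1}`, and `t i = 1` forces equal neighbouring diagonal entries; the last rows of
the Jordan blocks are the indices `m` with `(m : ℕ) = n - 1` or `t m = 0`).  For distinct
leaders `c 1, …, c r`, the geometric multiplicity of an eigenvalue `μ` is the number of
Jordan blocks with eigenvalue `μ`, i.e. the number of block-last rows `m` with `d m = μ`.
Then: (a) the pair `(L, (e_{c 1}, …, e_{c r}))` is controllable iff for every `μ` the matrix
`Ω_μ` has full row rank (equal to the geometric multiplicity of `μ`); and (b) the system is
`r`-leaders controllable with leaders `c 1, …, c r` (controllable, with no leader set of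
cardinality `< r` controllable) iff the columns `η^{c 1}, …, η^{c r}` of `P⁻¹` satisfy the
rank condition of (a) and no set of fewer than `r` columns of `P⁻¹` satisfies it. -/
theorem r_leaders_controllability {n r : ℕ} (hn : 0 < n)
    (w : Matrix (Fin n) (Fin n) ℝ)
    (hw_noloop : ∀ i, w i i = 0) (hw_nonneg : ∀ i j, 0 ≤ w i j)
    (L : Matrix (Fin n) (Fin n) ℝ)
    (hL : ∀ i j, L i j = if i = j then ∑ k, w i k else -w i j)
    (P J : Matrix (Fin n) (Fin n) ℂ) (d t : Fin n → ℂ)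
    (hP : IsUnit P.det)
    (hJ : ∀ i j, J i j = if j = i then d i else if (j : ℕ) = (i : ℕ) + 1 then t i else 0)
    (ht01 : ∀ i, t i = 0 ∨ t i = 1)
    (hblk : ∀ i j : Fin n, (j : ℕ) = (i : ℕ) + 1 → t i = 1 → d j = d i)
    (hdecomp : P⁻¹ * (L.map (fun x : ℝ => (x : ℂ))) * P = J)
    (c : Fin r → Fin n) (hc : Function.Injective c) :
    ((ctrbMatMulti L c).rank = n ↔
      ∀ μ : ℂ, (omegaMat P⁻¹ d t μ c).rank =
        Fintype.card {m : Fin n // ((m : ℕ) = n - 1 ∨ t m = 0) ∧ d m = μ}) ∧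
    (((ctrbMatMulti L c).rank = n ∧
        ∀ S : Finset (Fin n), S.card < r →
          (ctrbMatMulti L (fun j : {x // x ∈ S} => (j : Fin n))).rank ≠ n) ↔
      ((∀ μ : ℂ, (omegaMat P⁻¹ d t μ c).rank =
          Fintype.card {m : Fin n // ((m : ℕ) = n - 1 ∨ t m = 0) ∧ d m = μ}) ∧
        ∀ S : Finset (Fin n), S.card < r →
          ¬ (∀ μ : ℂ, (omegaMat P⁻¹ d t μ (fun j : {x // x ∈ S} => (j : Fin n))).rank =
            Fintype.card {m : Fin n // ((m : ℕ) = n - 1 ∨ t m = 0) ∧ d m = μ}))) := by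
  have key {κ : Type} [Fintype κ] (a : κ → Fin n) :=
    rank_ctrbMatMulti_eq_iff_omegaMat L P J d t hP hJ ht01 hblk hdecomp a
  exact ⟨key c, and_congr (key c) (forall₂_congr fun S _ => not_congr (key _))⟩
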